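/- arXiv:1411.1349 — 6 statements merged into one kernel-verified Lean document; each statement's English description precedes it below -/
import Mathlib

section
/- Let M be a monoidal model category such that for every cofibrant object C of M, the functors C⊗−: M → M and −⊗C: M → M preserve weak equivalences. Then M satisfies the very strong unit axiom for every cofibrant resolution of the tensor unit. -/
open CategoryTheory CategoryTheory.Limits MonoidalCategory

universe v u v' u'

namespace Muro

variable {C : Type u} [Category.{v} C]

/-- `f` is a retract of `g` in the arrow category. -/
structure IsRetractOfArrow {X Y X' Y' : C} (f : X ⟶ Y) (g : X' ⟶ Y') : Prop where
  intro ::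
  nonempty : ∃ (i : X ⟶ X') (r : X' ⟶ X) (i' : Y ⟶ Y') (r' : Y' ⟶ Y),
    i ≫ r = 𝟙 X ∧ i' ≫ r' = 𝟙 Y ∧ i ≫ g = f ≫ i' ∧ r ≫ f = g ≫ r'

/-- A model structure on a category `C`: weak equivalences, cofibrations and
fibrations, subject to the usual axioms (2-out-of-3, closure under retracts,
lifting and factorization). -/
structure ModelStructure (C : Type u) [Category.{v} C] where
  W : MorphismProperty C
  Cof : MorphismProperty C
  Fib : MorphismProperty C
  W_id : ∀ X : C, W (𝟙 X)
  W_comp : ∀ ⦃X Y Z : C⦄ (f : X ⟶ Y) (g : Y ⟶ Z), W f → W g → W (f ≫ g)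
  W_of_comp_left : ∀ ⦃X Y Z : C⦄ (f : X ⟶ Y) (g : Y ⟶ Z), W f → W (f ≫ g) → W g
  W_of_comp_right : ∀ ⦃X Y Z : C⦄ (f : X ⟶ Y) (g : Y ⟶ Z), W g → W (f ≫ g) → W f
  W_retract : ∀ ⦃X Y X' Y' : C⦄ (f : X ⟶ Y) (g : X' ⟶ Y'),
    IsRetractOfArrow f g → W g → W f
  Cof_retract : ∀ ⦃X Y X' Y' : C⦄ (f : X ⟶ Y) (g : X' ⟶ Y'),
    IsRetractOfArrow f g → Cof g → Cof f
  Fib_retract : ∀ ⦃X Y X' Y' : C⦄ (f : X ⟶ Y) (g : X' ⟶ Y'),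
    IsRetractOfArrow f g → Fib g → Fib f
  lift_cof_trivFib : ∀ ⦃A B X Y : C⦄ (i : A ⟶ B) (p : X ⟶ Y),
    Cof i → Fib p → W p → HasLiftingProperty i p
  lift_trivCof_fib : ∀ ⦃A B X Y : C⦄ (i : A ⟶ B) (p : X ⟶ Y),
    Cof i → W i → Fib p → HasLiftingProperty i p
  factor_cof_trivFib : ∀ ⦃X Y : C⦄ (f : X ⟶ Y),
    ∃ (Z : C) (i : X ⟶ Z) (p : Z ⟶ Y), Cof i ∧ Fib p ∧ W p ∧ i ≫ p = f
  factor_trivCof_fib : ∀ ⦃X Y : C⦄ (f : X ⟶ Y),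
    ∃ (Z : C) (i : X ⟶ Z) (p : Z ⟶ Y), Cof i ∧ W i ∧ Fib p ∧ i ≫ p = f

/-- Trivial fibrations. -/
def ModelStructure.TrivFib (M : ModelStructure C) : MorphismProperty C :=
  fun _ _ f => M.Fib f ∧ M.W f

/-- Trivial cofibrations. -/
def ModelStructure.TrivCof (M : ModelStructure C) : MorphismProperty C :=
  fun _ _ f => M.Cof f ∧ M.W f

section Initial

variable [HasInitial C]

/-- An object is cofibrant if the map from the initial object is a cofibration. -/
def ModelStructure.Cofibrant (M : ModelStructure C) (X : C) : Prop :=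
  M.Cof (initial.to X)

end Initial

section Terminal

variable [HasTerminal C]

/-- An object is fibrant if the map to the terminal object is a fibration. -/
def ModelStructure.Fibrant (M : ModelStructure C) (X : C) : Prop :=
  M.Fib (terminal.from X)

end Terminal

section Monoidal

variable [MonoidalCategory C] [HasPushouts C]

/-- The push-out product `f ⊙ g : X⊗V ∪_{X⊗U} Y⊗U ⟶ Y⊗V` of `f : X ⟶ Y` and
`g : U ⟶ V`. -/
noncomputable def pushoutProduct {X Y U V : C} (f : X ⟶ Y) (g : U ⟶ V) :
    pushout (X ◁ g) (f ▷ U) ⟶ Y ⊗ V :=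
  pushout.desc (f ▷ V) (Y ◁ g) (whisker_exchange f g)

/-- The push-out product axiom of a monoidal model category. -/
def PushoutProductAxiom (M : ModelStructure C) : Prop :=
  (∀ ⦃X Y U V : C⦄ (f : X ⟶ Y) (g : U ⟶ V),
    M.Cof f → M.Cof g → M.Cof (pushoutProduct f g)) ∧
  (∀ ⦃X Y U V : C⦄ (f : X ⟶ Y) (g : U ⟶ V),
    M.Cof f → M.W f → M.Cof g → M.W (pushoutProduct f g)) ∧
  (∀ ⦃X Y U V : C⦄ (f : X ⟶ Y) (g : U ⟶ V),
    M.Cof f → M.Cof g → M.W g → M.W (pushoutProduct f g))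

variable [HasInitial C]

/-- `q : T ⟶ 𝟙` is a cofibrant resolution of the tensor unit: a weak
equivalence with cofibrant source. -/
def IsCofibrantResolutionOfUnit (M : ModelStructure C) {T : C} (q : T ⟶ 𝟙_ C) : Prop :=
  M.Cofibrant T ∧ M.W q

/-- The unit axiom of a monoidal model category: there is a cofibrant resolution
`q : 𝟙̃ ⟶ 𝟙` of the tensor unit such that `q ⊗ X` and `X ⊗ q` are weak
equivalences for every cofibrant `X`. -/
def UnitAxiom (M : ModelStructure C) : Prop :=
  ∃ (T : C) (q : T ⟶ 𝟙_ C), IsCofibrantResolutionOfUnit M q ∧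
    ∀ X : C, M.Cofibrant X → M.W (q ▷ X) ∧ M.W (X ◁ q)

/-- The very strong unit axiom for a cofibrant resolution `q : 𝟙̃ ⟶ 𝟙` of the
tensor unit: `q ⊗ X` and `X ⊗ q` are weak equivalences for *every* object `X`. -/
def VeryStrongUnitAxiom (M : ModelStructure C) {T : C} (q : T ⟶ 𝟙_ C) : Prop :=
  ∀ X : C, M.W (q ▷ X) ∧ M.W (X ◁ q)

/-- A monoidal model category: a model structure together with a monoidal
structure satisfying the push-out product axiom and the unit axiom. -/
structure MonoidalModel (C : Type u) [Category.{v} C] [MonoidalCategory C]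
    [HasInitial C] [HasPushouts C] extends ModelStructure C where
  ppAxiom : PushoutProductAxiom toModelStructure
  unitAxiom : UnitAxiom toModelStructure

/-- A map `f : X ⟶ Y` is surjective if the induced map
`M(𝟙, X) ⟶ M(𝟙, Y)` on hom-sets out of the tensor unit is surjective. -/
def SurjectiveOnUnit {X Y : C} (f : X ⟶ Y) : Prop :=
  Function.Surjective (fun g : 𝟙_ C ⟶ X => g ≫ f)

end Monoidal

end Muro

namespace Muro

/-- Every object receives a weak equivalence from a cofibrant object. -/
theorem ModelStructure.exists_cofibrant_replacement {C : Type u} [Category.{v} C] [HasInitial C]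
    (M : ModelStructure C) (X : C) :
    ∃ (Y : C) (p : Y ⟶ X), M.Cofibrant Y ∧ M.W p := by
  obtain ⟨Y, i, p, hi, -, hp, -⟩ := M.factor_cof_trivFib (initial.to X)
  refine ⟨Y, p, ?_, hp⟩
  rwa [ModelStructure.Cofibrant, Subsingleton.elim (initial.to Y) i]

/-- Tensoring a weak equivalence with the unit on the left gives a weak equivalence. -/
theorem ModelStructure.W_unit_whiskerLeft {C : Type u} [Category.{v} C] [MonoidalCategory C]
    (M : ModelStructure C) {X Y : C} (f : X ⟶ Y) (hf : M.W f) : M.W (𝟙_ C ◁ f) :=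
  M.W_retract _ f
    ⟨(λ_ X).hom, (λ_ X).inv, (λ_ Y).hom, (λ_ Y).inv, by simp, by simp, by simp, by simp⟩ hf

/-- Tensoring a weak equivalence with the unit on the right gives a weak equivalence. -/
theorem ModelStructure.W_whiskerRight_unit {C : Type u} [Category.{v} C] [MonoidalCategory C]
    (M : ModelStructure C) {X Y : C} (f : X ⟶ Y) (hf : M.W f) : M.W (f ▷ 𝟙_ C) :=
  M.W_retract _ f
    ⟨(ρ_ X).hom, (ρ_ X).inv, (ρ_ Y).hom, (ρ_ Y).inv, by simp, by simp, by simp, by simp⟩ hf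

/-- If in a monoidal model category `M` tensoring with any
cofibrant object, from the left or from the right, preserves weak
equivalences, then `M` satisfies the very strong unit axiom for every
cofibrant resolution of the tensor unit. -/
theorem veryStrongUnitAxiom_of_tensor_cofibrant_preserves
    {C : Type u} [Category.{v} C] [MonoidalCategory C] [HasInitial C]
    [HasPushouts C] (M : MonoidalModel C)
    (h : ∀ A : C, M.toModelStructure.Cofibrant A →
      (∀ ⦃X Y : C⦄ (f : X ⟶ Y), M.W f → M.W (A ◁ f)) ∧
      (∀ ⦃X Y : C⦄ (f : X ⟶ Y), M.W f → M.W (f ▷ A))) :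
    ∀ (T : C) (q : T ⟶ 𝟙_ C), IsCofibrantResolutionOfUnit M.toModelStructure q →
      VeryStrongUnitAxiom M.toModelStructure q := by
  rintro T q ⟨hT, hq⟩ X
  obtain ⟨Y, p, hY, hp⟩ := M.exists_cofibrant_replacement X
  constructor
  · refine M.W_of_comp_left (T ◁ p) _ ((h T hT).1 p hp) ?_
    rw [whisker_exchange]
    exact M.W_comp _ _ ((h Y hY).2 q hq) (M.W_unit_whiskerLeft p hp)
  · refine M.W_of_comp_left (p ▷ T) _ ((h T hT).2 p hp) ?_
    rw [← whisker_exchange]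
    exact M.W_comp _ _ ((h Y hY).1 q hq) (M.W_whiskerRight_unit p hp)

end Muro
end

section
/- Under the Setup (so that the model structure M̃ with generating cofibrations Ĩ and generating trivial cofibrations J̃ and the same weak equivalences as M exists): if M is right proper then M̃ is right proper, and if M is left proper then M̃ is left proper. -/
open CategoryTheory CategoryTheory.Limits MonoidalCategory

universe v u v' u'

namespace Muro

/-- A well-ordered index for transfinite compositions: a well-ordered set with
a bottom element and successors. -/
class WellOrderData (J : Type v) extends LinearOrder J, OrderBot J, SuccOrder J where
  wfLT : WellFoundedLT J

attribute [instance] WellOrderData.wfLT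

variable {C : Type u} [Category.{v} C]

section Sequences

variable {J : Type v} [Preorder J]

/-- The inclusion functor `Set.Iio j ⥤ J`. -/
def iioFunctor (j : J) : Set.Iio j ⥤ J :=
  Monotone.functor (f := fun i : Set.Iio j => (i : J)) (fun _ _ h => h)

/-- Restriction of `F : J ⥤ C` to `Set.Iio j`. -/
def restrictionLT (F : J ⥤ C) (j : J) : Set.Iio j ⥤ C :=
  iioFunctor j ⋙ F

/-- The cocone on `restrictionLT F j` with apex `F.obj j`. -/
@[simps]
def coconeLT (F : J ⥤ C) (j : J) : Cocone (restrictionLT F j) where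
  pt := F.obj j
  ι :=
    { app := fun i => F.map (homOfLE i.2.le)
      naturality := fun i₁ i₂ φ => by
        dsimp [restrictionLT, iioFunctor, Monotone.functor]
        rw [Category.comp_id, ← F.map_comp]
        congr 1 }

end Sequences

section TransfiniteComposition

variable (K : MorphismProperty C)

/-- A witness that `f : X ⟶ Y` is a transfinite composition, indexed by the
well-ordered set `J`, of maps in `K`: a smooth (i.e. continuous at limit
elements) `J`-indexed sequence starting at `X`, whose successor maps lie in
`K` and whose colimit is `Y`, the composition of the sequence being `f`. -/
structure TransfiniteCompositionOfShape (J : Type v) [WellOrderData J]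
    {X Y : C} (f : X ⟶ Y) where
  F : J ⥤ C
  isoBot : F.obj ⊥ ≅ X
  step : ∀ j : J, ¬ IsMax j → K (F.map (homOfLE (Order.le_succ j)))
  smooth : ∀ j : J, Order.IsSuccLimit j → Nonempty (IsColimit (coconeLT F j))
  ι : F ⟶ (Functor.const J).obj Y
  isColimit : IsColimit (Cocone.mk Y ι)
  fac : f = isoBot.inv ≫ ι.app ⊥

/-- The class of transfinite compositions of maps in `K`. -/
def transfiniteCompositions : MorphismProperty C :=
  fun _ _ f => ∃ (J : Type v) (hJ : WellOrderData J),
    letI := hJ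
    Nonempty (TransfiniteCompositionOfShape K J f)

/-- The class of pushouts of maps in `K`. -/
def pushoutsOf : MorphismProperty C :=
  fun X Y f => ∃ (A B : C) (g : A ⟶ B) (u : A ⟶ X) (v : B ⟶ Y),
    K g ∧ IsPushout u g f v

/-- Relative `K`-cell complexes: transfinite compositions of pushouts of maps
in `K`. -/
def relativeCellComplexes : MorphismProperty C :=
  transfiniteCompositions (pushoutsOf K)

/-- `K`-injective maps: maps with the right lifting property with respect to
all maps in `K`. -/
def rlp : MorphismProperty C :=
  fun _ _ p => ∀ ⦃A B : C⦄ (i : A ⟶ B), K i → HasLiftingProperty i p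

/-- Maps with the left lifting property with respect to all maps in `K`.
`K`-cofibrations are the maps in `llp (rlp K)`. -/
def llp : MorphismProperty C :=
  fun _ _ i => ∀ ⦃A B : C⦄ (p : A ⟶ B), K p → HasLiftingProperty i p

/-- A smooth `J`-indexed sequence with successor maps in `K`. -/
structure SmoothSequence (J : Type v) [WellOrderData J] where
  F : J ⥤ C
  step : ∀ j : J, ¬ IsMax j → K (F.map (homOfLE (Order.le_succ j)))
  smooth : ∀ j : J, Order.IsSuccLimit j → Nonempty (IsColimit (coconeLT F j))

/-- The object `A` is small relative to the class of maps `K` (Hovey,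
Definition 2.1.3): there is a regular cardinal `κ` such that for every
`κ`-filtered well-ordered set `J` (i.e. one of cofinality `> κ`) and every
smooth `J`-indexed sequence with successor maps in `K` and colimit `c`, the
canonical map `colim_j C(A, F j) ⟶ C(A, c.pt)` is bijective (expressed
concretely as: every map `A ⟶ c.pt` factors through some stage, and two
factorizations through a stage are identified at some later stage). -/
def IsSmallRel (A : C) : Prop :=
  ∃ κ : Cardinal.{v}, κ.IsRegular ∧
    ∀ (J : Type v) (hJ : WellOrderData J),
      letI := hJ
      κ < (Ordinal.type ((· < ·) : J → J → Prop)).cof →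
      ∀ (S : SmoothSequence K J) (c : Cocone S.F), IsColimit c →
        (∀ g : A ⟶ c.pt, ∃ (j : J) (h : A ⟶ S.F.obj j), g = h ≫ c.ι.app j) ∧
        (∀ (j : J) (h h' : A ⟶ S.F.obj j), h ≫ c.ι.app j = h' ≫ c.ι.app j →
          ∃ (k : J) (hk : j ≤ k),
            h ≫ S.F.map (homOfLE hk) = h' ≫ S.F.map (homOfLE hk))

/-- The class `K` is indexed by a set (i.e. a small family of maps). -/
def IsSetIndexed : Prop :=
  ∃ (ι : Type v) (A B : ι → C) (g : ∀ i, A i ⟶ B i),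
    ∀ ⦃X Y : C⦄ (f : X ⟶ Y), K f ↔ ∃ i, Arrow.mk f = Arrow.mk (g i)

end TransfiniteComposition

/-- `M` is cofibrantly generated by the set `I` of generating cofibrations and
the set `Jg` of generating trivial cofibrations. -/
structure CofibrantlyGeneratedBy (M : ModelStructure C)
    (I Jg : MorphismProperty C) : Prop where
  setI : IsSetIndexed I
  setJ : IsSetIndexed Jg
  smallI : ∀ ⦃A B : C⦄ (i : A ⟶ B), I i → IsSmallRel (relativeCellComplexes I) A
  smallJ : ∀ ⦃A B : C⦄ (i : A ⟶ B), Jg i → IsSmallRel (relativeCellComplexes Jg) A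
  fib_eq : M.Fib = rlp Jg
  trivFib_eq : M.TrivFib = rlp I

end Muro

namespace Muro

variable {C : Type u} [Category.{v} C] [MonoidalCategory C] [HasInitial C]
  [HasPushouts C] [HasBinaryCoproducts C]

/-- `Ĩ = I ∪ {∅ ⟶ 𝟙}`. -/
def tildeI (I : MorphismProperty C) : MorphismProperty C :=
  fun _ _ f => I f ∨ Arrow.mk f = Arrow.mk (initial.to (𝟙_ C))

/-- `J̃ = J ∪ {j ∘ i₁ : 𝟙̃ ⟶ C}` for a given map `ji₁ : 𝟙̃ ⟶ C`. -/
def tildeJ (Jg : MorphismProperty C) {T Cob : C} (ji₁ : T ⟶ Cob) :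
    MorphismProperty C :=
  fun _ _ f => Jg f ∨ Arrow.mk f = Arrow.mk ji₁

/-- The Setup of the paper: `M` is a cofibrantly generated monoidal model
category satisfying the very strong unit axiom for a cofibrant resolution
`q : 𝟙̃ ⟶ 𝟙`, with generating cofibrations `I` and generating trivial
cofibrations `Jg`; a factorization `𝟙̃ ⊔ 𝟙 —j→ C —p→ 𝟙` of `(q, id)` into a
cofibration followed by a weak equivalence is fixed; the domains of `I` are
small relative to relative `Ĩ`-cell complexes, and the domains of `Jg` are
small relative to relative `J̃`-cell complexes, where `Ĩ = I ∪ {∅ ⟶ 𝟙}` and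
`J̃ = Jg ∪ {j ∘ i₁}`. -/
structure Setup (C : Type u) [Category.{v} C] [MonoidalCategory C]
    [HasInitial C] [HasPushouts C] [HasBinaryCoproducts C] where
  M : ModelStructure C
  ppAxiom : PushoutProductAxiom M
  unitAxiom : UnitAxiom M
  I : MorphismProperty C
  Jg : MorphismProperty C
  cofGen : CofibrantlyGeneratedBy M I Jg
  T : C
  q : T ⟶ 𝟙_ C
  resolution : IsCofibrantResolutionOfUnit M q
  vsua : VeryStrongUnitAxiom M q
  Cob : C
  j : T ⨿ 𝟙_ C ⟶ Cob
  p : Cob ⟶ 𝟙_ C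
  cof_j : M.Cof j
  weq_p : M.W p
  factorization : j ≫ p = coprod.desc q (𝟙 (𝟙_ C))
  smallI : ∀ ⦃A B : C⦄ (i : A ⟶ B), I i →
    IsSmallRel (relativeCellComplexes (tildeI I)) A
  smallJ : ∀ ⦃A B : C⦄ (i : A ⟶ B), Jg i →
    IsSmallRel (relativeCellComplexes
      (tildeJ Jg ((coprod.inl : T ⟶ T ⨿ 𝟙_ C) ≫ j))) A

/-- The map `j ∘ i₁ : 𝟙̃ ⟶ C` of the Setup. -/
noncomputable def Setup.ji₁ (S : Setup C) : S.T ⟶ S.Cob :=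
  (coprod.inl : S.T ⟶ S.T ⨿ 𝟙_ C) ≫ S.j

/-- The set `Ĩ` of the Setup. -/
def Setup.tI (S : Setup C) : MorphismProperty C := tildeI S.I

/-- The set `J̃` of the Setup. -/
noncomputable def Setup.tJ (S : Setup C) : MorphismProperty C := tildeJ S.Jg S.ji₁

/-- `Mt` is the model structure `M̃` of the paper associated with the Setup
`S`: it has the same weak equivalences as `M`, it is generated by `Ĩ` and `J̃`,
i.e. its trivial fibrations are the `Ĩ`-injective maps, its fibrations are the
`J̃`-injective maps, and its cofibrations are the `Ĩ`-cofibrations. -/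
structure Setup.IsTildeModel (S : Setup C) (Mt : ModelStructure C) : Prop where
  weq_eq : Mt.W = S.M.W
  trivFib_eq : Mt.TrivFib = rlp S.tI
  fib_eq : Mt.Fib = rlp S.tJ
  cof_eq : Mt.Cof = llp (rlp S.tI)

end Muro

namespace Muro

variable {C : Type u} [Category.{v} C]

/-- Right properness: weak equivalences are preserved by pullback along
fibrations. -/
def RightProper (M : ModelStructure C) : Prop :=
  ∀ ⦃P X Z Y : C⦄ (fst : P ⟶ X) (snd : P ⟶ Z) (f : X ⟶ Y) (g : Z ⟶ Y),
    M.W f → M.Fib g → IsPullback fst snd f g → M.W snd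

/-- Left properness: weak equivalences are preserved by pushout along
cofibrations. -/
def LeftProper (M : ModelStructure C) : Prop :=
  ∀ ⦃X Y Z P : C⦄ (f : X ⟶ Y) (g : X ⟶ Z) (inl : Y ⟶ P) (inr : Z ⟶ P),
    M.W f → M.Cof g → IsPushout f g inl inr → M.W inr

section Monoidal

variable [MonoidalCategory C]

/-- The class of maps of the form `t ⊗ Z` with `t` a trivial cofibration and
`Z` any object. -/
def tensorTrivCofMaps (M : ModelStructure C) : MorphismProperty C :=
  fun _ _ g => ∃ (A B Z : C) (t : A ⟶ B), M.Cof t ∧ M.W t ∧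
    Arrow.mk g = Arrow.mk (t ▷ Z)

/-- The monoid axiom: every transfinite composition of pushouts of maps of the
form `t ⊗ Z`, with `t` a trivial cofibration and `Z` any object, is a weak
equivalence. -/
def MonoidAxiom (M : ModelStructure C) : Prop :=
  ∀ ⦃X Y : C⦄ (f : X ⟶ Y),
    transfiniteCompositions (pushoutsOf (tensorTrivCofMaps M)) f → M.W f

/-- An object `A` is cofibrant mod `𝟙` if it is a retract of an object `X`
admitting a cofibration `𝟙^(S) ⟶ X` from a coproduct of copies of the tensor
unit indexed by some (possibly empty) set `S`. -/
def CofibrantModOne [HasCoproducts.{v} C] (M : ModelStructure C) (A : C) : Prop :=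
  ∃ (X : C) (i : A ⟶ X) (r : X ⟶ A), i ≫ r = 𝟙 A ∧
    ∃ (S : Type v) (c : (∐ fun _ : S => 𝟙_ C) ⟶ X), M.Cof c

/-- Pseudo-cofibrations: maps `f` such that `f ⊙ g` and `g ⊙ f` are
cofibrations for every cofibration `g`, and trivial cofibrations for every
trivial cofibration `g`. -/
def PseudoCofibrations [HasPushouts C] (M : ModelStructure C) :
    MorphismProperty C :=
  fun _ _ f =>
    (∀ ⦃U V : C⦄ (g : U ⟶ V), M.Cof g →
      M.Cof (pushoutProduct f g) ∧ M.Cof (pushoutProduct g f)) ∧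
    (∀ ⦃U V : C⦄ (g : U ⟶ V), M.Cof g → M.W g →
      (M.Cof (pushoutProduct f g) ∧ M.W (pushoutProduct f g)) ∧
      (M.Cof (pushoutProduct g f) ∧ M.W (pushoutProduct g f)))

end Monoidal

end Muro

namespace Muro

section KenBrown

variable {C : Type u} [Category.{v} C]

namespace ModelStructure

variable (M : ModelStructure C)

lemma isRetractOfArrow_of_fac {A B Z : C} {i : A ⟶ B} {k : A ⟶ Z} {p : Z ⟶ B}
    (fac : k ≫ p = i) [HasLiftingProperty i p] : IsRetractOfArrow i k := by
  have sq : CommSq k i p (𝟙 B) := ⟨by simp [fac]⟩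
  exact ⟨⟨𝟙 A, 𝟙 A, sq.lift, p, by simp, sq.fac_right, by simp, by simp [fac]⟩⟩

lemma cof_iff_lifts {A B : C} (i : A ⟶ B) :
    M.Cof i ↔ ∀ ⦃X Y : C⦄ (p : X ⟶ Y), M.Fib p → M.W p → HasLiftingProperty i p := by
  refine ⟨fun hi _ _ p => M.lift_cof_trivFib i p hi, fun h => ?_⟩
  obtain ⟨Z, k, p, hk, hp, hp', fac⟩ := M.factor_cof_trivFib i
  have := h p hp hp'
  exact M.Cof_retract i k (isRetractOfArrow_of_fac fac) hk

lemma W_of_lifts {A B : C} (i : A ⟶ B)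
    (h : ∀ ⦃X Y : C⦄ (p : X ⟶ Y), M.Fib p → HasLiftingProperty i p) : M.W i := by
  obtain ⟨Z, k, p, -, hk, hp, fac⟩ := M.factor_trivCof_fib i
  have := h p hp
  exact M.W_retract i k (isRetractOfArrow_of_fac fac) hk

lemma cof_comp {X Y Z : C} {f : X ⟶ Y} {g : Y ⟶ Z} (hf : M.Cof f) (hg : M.Cof g) :
    M.Cof (f ≫ g) := by
  rw [cof_iff_lifts] at hf hg ⊢
  intro _ _ p hp hp'
  have := hf p hp hp'
  have := hg p hp hp'
  infer_instance

lemma cof_of_isPushout {X Y Z P : C} {f : X ⟶ Y} {g : X ⟶ Z} {inl : Y ⟶ P} {inr : Z ⟶ P}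
    (sq : IsPushout f g inl inr) (hg : M.Cof g) : M.Cof inl := by
  rw [cof_iff_lifts] at hg ⊢
  intro _ _ p hp hp'
  have := hg p hp hp'
  exact sq.hasLiftingProperty p

lemma W_of_isPushout {X Y Z P : C} {f : X ⟶ Y} {g : X ⟶ Z} {inl : Y ⟶ P} {inr : Z ⟶ P}
    (sq : IsPushout f g inl inr) (hg : M.Cof g) (hg' : M.W g) : M.W inl := by
  refine M.W_of_lifts inl fun _ _ p hp => ?_
  have := M.lift_trivCof_fib g p hg hg' hp
  exact sq.hasLiftingProperty p

/-- Cobase change along `f` sends a trivial cofibration under the source of `f`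
to a weak equivalence. -/
lemma W_cobaseChange_of_trivCof {X Y A B P Q : C} {f : X ⟶ Y} {a : X ⟶ A} {b : X ⟶ B}
    {inlP : Y ⟶ P} {inrP : A ⟶ P} {inlQ : Y ⟶ Q} {inrQ : B ⟶ Q}
    (hP : IsPushout f a inlP inrP) (hQ : IsPushout f b inlQ inrQ)
    {w : A ⟶ B} (hw : M.Cof w) (hw' : M.W w) (fac : a ≫ w = b)
    {d : P ⟶ Q} (hd : inlP ≫ d = inlQ) (hd' : inrP ≫ d = w ≫ inrQ) : M.W d := by
  subst fac hd
  exact M.W_of_isPushout (hQ.of_top hd' hP) hw hw'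

/-- Ken Brown's lemma for cobase change: cobase change along `f` sends a weak
equivalence between cofibrant objects under the source of `f` to a weak equivalence. -/
lemma W_cobaseChange [HasPushouts C] {X Y A B P Q : C} {f : X ⟶ Y} {a : X ⟶ A} {b : X ⟶ B}
    {inlP : Y ⟶ P} {inrP : A ⟶ P} {inlQ : Y ⟶ Q} {inrQ : B ⟶ Q}
    (hP : IsPushout f a inlP inrP) (hQ : IsPushout f b inlQ inrQ)
    (ha : M.Cof a) (hb : M.Cof b) {w : A ⟶ B} (hw : M.W w) (fac : a ≫ w = b)
    {d : P ⟶ Q} (hd : inlP ≫ d = inlQ) (hd' : inrP ≫ d = w ≫ inrQ) : M.W d := by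
  have sq := IsPushout.of_hasPushout a b
  obtain ⟨R, k, r, hk, -, hr, hkr⟩ := M.factor_cof_trivFib (sq.desc w (𝟙 B) (by simp [fac]))
  have inl_fac : (pushout.inl a b ≫ k) ≫ r = w := by
    rw [Category.assoc, hkr, sq.inl_desc]
  have inr_fac : (pushout.inr a b ≫ k) ≫ r = 𝟙 B := by
    rw [Category.assoc, hkr, sq.inr_desc]
  have hA : M.Cof (pushout.inl a b ≫ k) := M.cof_comp (M.cof_of_isPushout sq hb) hk
  have hB : M.Cof (pushout.inr a b ≫ k) := M.cof_comp (M.cof_of_isPushout sq.flip ha) hk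
  have hA' : M.W (pushout.inl a b ≫ k) :=
    M.W_of_comp_right _ r hr (by rw [inl_fac]; exact hw)
  have hB' : M.W (pushout.inr a b ≫ k) :=
    M.W_of_comp_right _ r hr (by rw [inr_fac]; exact M.W_id B)
  have hab : a ≫ pushout.inl a b ≫ k = b ≫ pushout.inr a b ≫ k := by
    rw [pushout.condition_assoc]
  generalize pushout.inl a b ≫ k = s at *
  generalize pushout.inr a b ≫ k = t at *
  have hR := IsPushout.of_hasPushout f (b ≫ t)
  let dA : P ⟶ pushout f (b ≫ t) :=
    hP.desc (pushout.inl _ _) (s ≫ pushout.inr _ _)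
      (by rw [hR.w, reassoc_of% hab, Category.assoc])
  let dB : Q ⟶ pushout f (b ≫ t) :=
    hQ.desc (pushout.inl _ _) (t ≫ pushout.inr _ _)
      (by rw [hR.w, Category.assoc])
  let dR : pushout f (b ≫ t) ⟶ Q :=
    hR.desc inlQ (r ≫ inrQ)
      (by rw [Category.assoc, reassoc_of% inr_fac, hQ.w])
  have hdA : M.W dA := M.W_cobaseChange_of_trivCof hP hR hA hA' hab (by simp [dA]) (by simp [dA])
  have hdB : M.W dB := M.W_cobaseChange_of_trivCof hQ hR hB hB' rfl (by simp [dB]) (by simp [dB])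
  have hBR : dB ≫ dR = 𝟙 Q := hQ.hom_ext (by simp [dB, dR])
    (by simp [dB, dR, reassoc_of% inr_fac])
  have hAR : dA ≫ dR = d := hP.hom_ext (by simp [dA, dR, hd])
    (by simp [dA, dR, hd', reassoc_of% inl_fac])
  have hdR : M.W dR := M.W_of_comp_left dB dR hdB (by rw [hBR]; exact M.W_id Q)
  rw [← hAR]
  exact M.W_comp dA dR hdA hdR

end ModelStructure

/-- Left properness passes to a model structure with the same weak equivalences
and more cofibrations. -/
lemma LeftProper.of_cof_le [HasPushouts C] {M N : ModelStructure C} (hM : LeftProper M)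
    (hW : N.W = M.W) (hCof : ∀ ⦃X Y : C⦄ (f : X ⟶ Y), M.Cof f → N.Cof f) : LeftProper N := by
  intro X Y Z P f g inl inr hf hg sq
  obtain ⟨Z', k, r, hk, -, hr, fac⟩ := M.factor_cof_trivFib g
  rw [hW] at hf
  rw [← hW] at hr
  have sq' := IsPushout.of_hasPushout f k
  have hZ' : N.W (pushout.inr f k) := by
    rw [hW]
    exact hM f k _ _ hf hk sq'
  let d : pushout f k ⟶ P :=
    sq'.desc inl (r ≫ inr) (by rw [reassoc_of% fac, sq.w])
  have hd : N.W d :=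
    N.W_cobaseChange sq' sq (hCof k hk) hg hr fac (by simp [d]) (by simp [d])
  refine N.W_of_comp_left r inr hr ?_
  have e : pushout.inr f k ≫ d = r ≫ inr := by simp [d]
  rw [← e]
  exact N.W_comp _ _ hZ' hd

/-- Right properness passes to a model structure with the same weak equivalences
and fewer fibrations. -/
lemma RightProper.of_fib_le {M N : ModelStructure C} (hM : RightProper M)
    (hW : N.W = M.W) (hFib : ∀ ⦃X Y : C⦄ (f : X ⟶ Y), N.Fib f → M.Fib f) : RightProper N := by
  intro P X Z Y fst snd f g hf hg sq
  rw [hW] at hf ⊢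
  exact hM fst snd f g hf (hFib g hg) sq

end KenBrown

/-- Under the Setup, if `M` is right proper then so is `M̃`,
and if `M` is left proper then so is `M̃`. -/
theorem tilde_proper {C : Type u} [Category.{v} C] [MonoidalCategory C]
    [HasInitial C] [HasPushouts C] [HasBinaryCoproducts C] (S : Setup C)
    (Mt : ModelStructure C) (hMt : S.IsTildeModel Mt) :
    (RightProper S.M → RightProper Mt) ∧ (LeftProper S.M → LeftProper Mt) := by
  refine ⟨fun h => h.of_fib_le hMt.weq_eq fun X Y f hf => ?_,
    fun h => h.of_cof_le hMt.weq_eq fun X Y f hf => ?_⟩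
  · rw [hMt.fib_eq] at hf
    rw [S.cofGen.fib_eq]
    exact fun _ _ i hi => hf i (Or.inl hi)
  · rw [hMt.cof_eq]
    intro A B p hp
    have hp' : S.M.TrivFib p := by
      rw [S.cofGen.trivFib_eq]
      exact fun _ _ i hi => hp i (Or.inl hi)
    exact S.M.lift_cof_trivFib f p hf hp'.1 hp'.2

end Muro
end

section
/- Let M be a cofibrantly generated monoidal model category with set of generating cofibrations I, initial object ∅ and tensor unit 𝟙, and set Ĩ = I ∪ {∅ → 𝟙}. Then a map X → Y is a relative Ĩ-cell complex if and only if it factors as X → X ⊔ 𝟙^(S) → Y, where 𝟙^(S) is a coproduct of copies of 𝟙 indexed by some set S, the first arrow is the inclusion of the first coproduct factor, and the second arrow is a relative I-cell complex. -/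
open CategoryTheory CategoryTheory.Limits MonoidalCategory

universe v u v' u'

namespace Muro

section Towers

variable {C : Type u} [Category.{v} C]

lemma map_homOfLE_comp {J : Type*} [Preorder J] (F : J ⥤ C) {a b c : J} (h : a ≤ b) (h' : b ≤ c) :
    F.map (homOfLE h) ≫ F.map (homOfLE h') = F.map (homOfLE (h.trans h')) := by
  rw [← F.map_comp, homOfLE_comp]

lemma map_homOfLE_comp_assoc {J : Type*} [Preorder J] (F : J ⥤ C) {a b c : J} (h : a ≤ b)
    (h' : b ≤ c) {Z : C} (g : F.obj c ⟶ Z) :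
    F.map (homOfLE h) ≫ F.map (homOfLE h') ≫ g = F.map (homOfLE (h.trans h')) ≫ g := by
  rw [← map_homOfLE_comp F h h', Category.assoc]

lemma map_homOfLE_self {J : Type*} [Preorder J] (F : J ⥤ C) {a : J} (h : a ≤ a) :
    F.map (homOfLE h) = 𝟙 _ :=
  F.map_id a

/-- `F.obj j` is the colimit of the objects `F.obj i` for `i < j`, expressed elementwise. -/
def SmoothAt {J : Type*} [Preorder J] (F : J ⥤ C) (j : J) : Prop :=
  ∀ (Z : C) (φ : ∀ i, i < j → (F.obj i ⟶ Z)),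
    (∀ i i' (h : i ≤ i') (h' : i' < j),
      F.map (homOfLE h) ≫ φ i' h' = φ i (h.trans_lt h')) →
    ∃! ψ : F.obj j ⟶ Z, ∀ i (hi : i < j), F.map (homOfLE hi.le) ≫ ψ = φ i hi

lemma smoothAt_iff {J : Type v} [Preorder J] (F : J ⥤ C) (j : J) :
    SmoothAt F j ↔ Nonempty (IsColimit (coconeLT F j)) := by
  constructor
  · intro h
    have key : ∀ s : Cocone (restrictionLT F j), ∃! ψ : F.obj j ⟶ s.pt,
        ∀ i (hi : i < j), F.map (homOfLE hi.le) ≫ ψ = s.ι.app ⟨i, hi⟩ := fun s =>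
      h s.pt (fun i hi => s.ι.app ⟨i, hi⟩) (fun i i' hi h' =>
        s.w (homOfLE hi : (⟨i, hi.trans_lt h'⟩ : Set.Iio j) ⟶ ⟨i', h'⟩))
    exact ⟨{ desc := fun s => (key s).choose
             fac := fun s i => (key s).choose_spec.1 i.1 i.2
             uniq := fun s m hm => (key s).choose_spec.2 m fun i hi => hm ⟨i, hi⟩ }⟩
  · rintro ⟨h⟩ Z φ hφ
    let s : Cocone (restrictionLT F j) :=
      { pt := Z
        ι := { app := fun i => φ i.1 i.2
               naturality := fun i i' f => by
                 exact (hφ i.1 i'.1 (leOfHom f) i'.2).trans (Category.comp_id _).symm } }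
    exact ⟨h.desc s, fun i hi => h.fac s ⟨i, hi⟩, fun m hm => h.uniq s m fun i => hm i.1 i.2⟩

/-- `f` is a transfinite composition of maps in `P`, indexed by a well-ordered set
with a largest element. -/
def HasTower (P : MorphismProperty C) {X Y : C} (f : X ⟶ Y) : Prop :=
  ∃ (J : Type v) (_ : LinearOrder J) (_ : BoundedOrder J) (_ : WellFoundedLT J) (F : J ⥤ C)
    (e : F.obj ⊥ ≅ X) (e' : F.obj ⊤ ≅ Y),
    f = e.inv ≫ F.map (homOfLE bot_le) ≫ e'.hom ∧
    (∀ a b (h : a ⋖ b), P (F.map (homOfLE h.le))) ∧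
    ∀ j, Order.IsSuccLimit j → SmoothAt F j

lemma HasTower.mono {P Q : MorphismProperty C} (hPQ : P ≤ Q) {X Y : C} {f : X ⟶ Y}
    (h : HasTower P f) : HasTower Q f := by
  obtain ⟨J, _, _, _, F, e, e', hf, hs, hl⟩ := h
  exact ⟨J, _, _, ‹_›, F, e, e', hf, fun a b h => hPQ _ (hs a b h), hl⟩

lemma HasTower.transfiniteCompositions {P : MorphismProperty C} {X Y : C} {f : X ⟶ Y}
    (h : HasTower P f) : transfiniteCompositions P f := by
  obtain ⟨J, i₁, i₂, i₃, F, e, e', hf, hs, hl⟩ := h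
  let hJ : WellOrderData J :=
    { i₁, i₂.toOrderBot, SuccOrder.ofLinearWellFoundedLT J with wfLT := i₃ }
  refine ⟨J, hJ, ⟨{
    F := F
    isoBot := e
    step := ?_
    smooth := ?_
    ι := (coconeOfDiagramTerminal isTerminalTop F).ι ≫ (Functor.const J).map e'.hom
    isColimit := IsColimit.ofIsoColimit (colimitOfDiagramTerminal isTerminalTop F)
      (Cocone.ext e' (fun j => by simp))
    fac := ?_ }⟩⟩
  · intro j hj
    exact hs _ _ (Order.covBy_succ_of_not_isMax hj)
  · intro j hj
    exact (smoothAt_iff F j).1 (hl j hj)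
  · rw [hf]
    rfl

lemma hasTower_id (P : MorphismProperty C) (X : C) : HasTower P (𝟙 X) := by
  refine ⟨PUnit, inferInstance, inferInstance, inferInstance, (Functor.const _).obj X,
    Iso.refl _, Iso.refl _, by simp, ?_, ?_⟩
  · intro a b h
    exact (h.lt.ne (Subsingleton.elim _ _)).elim
  · intro j hj
    exact (hj.1 (fun x _ => (Subsingleton.elim _ _ : j = x).le)).elim

/-- The functor out of an ordinal sum assembled from functors on the summands and a compatible
family of maps between them. -/
def lexSumFunctor {A B : Type v} [LinearOrder A] [LinearOrder B] (F : A ⥤ C) (G : B ⥤ C)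
    (α : ∀ a b, F.obj a ⟶ G.obj b)
    (hF : ∀ a a' b (h : a ≤ a'), F.map (homOfLE h) ≫ α a' b = α a b)
    (hG : ∀ a b b' (h : b ≤ b'), α a b ≫ G.map (homOfLE h) = α a b') :
    (A ⊕ₗ B) ⥤ C where
  obj x := Sum.elim F.obj G.obj (ofLex x)
  map {x y} f := match x, y, leOfHom f with
    | .inlₗ _, .inlₗ _, h => F.map (homOfLE (Sum.Lex.inl_le_inl_iff.1 h))
    | .inlₗ a, .inrₗ b, _ => α a b
    | .inrₗ _, .inlₗ _, h => (Sum.Lex.not_inr_le_inl h).elim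
    | .inrₗ _, .inrₗ _, h => G.map (homOfLE (Sum.Lex.inr_le_inr_iff.1 h))
  map_id x := match x with
    | .inlₗ a => F.map_id a
    | .inrₗ b => G.map_id b
  map_comp {x y z} f g := match x, y, z, leOfHom f, leOfHom g with
    | .inlₗ _, .inlₗ _, .inlₗ _, _, _ => (map_homOfLE_comp F _ _).symm
    | .inlₗ _, .inlₗ _, .inrₗ _, h, _ => (hF _ _ _ (Sum.Lex.inl_le_inl_iff.1 h)).symm
    | .inlₗ _, .inrₗ _, .inrₗ _, _, h => (hG _ _ _ (Sum.Lex.inr_le_inr_iff.1 h)).symm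
    | .inrₗ _, .inrₗ _, .inrₗ _, _, _ => (map_homOfLE_comp G _ _).symm
    | .inrₗ _, .inlₗ _, _, h, _ => (Sum.Lex.not_inr_le_inl h).elim
    | _, .inrₗ _, .inlₗ _, _, h => (Sum.Lex.not_inr_le_inl h).elim

lemma HasTower.transfiniteCompositions_comp {P : MorphismProperty C} {X Y Z : C} {f : X ⟶ Y}
    {g : Y ⟶ Z} (hf : Muro.transfiniteCompositions P f) (hg : HasTower P g) :
    HasTower (P ⊔ MorphismProperty.isomorphisms C) (f ≫ g) := by
  obtain ⟨A, hA, ⟨t⟩⟩ := hf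
  obtain ⟨B, _, _, _, G, e, e', hg, hGs, hGl⟩ := hg
  have : WellFoundedLT (A ⊕ₗ B) := ⟨Sum.lex_wf wellFounded_lt wellFounded_lt⟩
  have hι : ∀ a a' (h : a ≤ a'), t.F.map (homOfLE h) ≫ t.ι.app a' = t.ι.app a := fun a a' h => by
    simp
  let H : (A ⊕ₗ B) ⥤ C := lexSumFunctor t.F G
    (fun a b => t.ι.app a ≫ e.inv ≫ G.map (homOfLE bot_le))
    (fun a a' b h => by rw [← Category.assoc, hι])
    (fun a b b' h => by simp only [Category.assoc, map_homOfLE_comp])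
  refine ⟨A ⊕ₗ B, inferInstance, inferInstance, this, H, t.isoBot, e', ?_, ?_, ?_⟩
  · change _ = t.isoBot.inv ≫ (t.ι.app ⊥ ≫ e.inv ≫ G.map _) ≫ e'.hom
    refine (congrArg₂ (· ≫ ·) t.fac hg).trans ?_
    simp only [Category.assoc]
  · rintro (a | b) (a' | b') h
    · have h' : a ⋖ a' := ⟨Sum.Lex.inl_lt_inl_iff.1 h.lt, fun c hc hc' =>
        h.2 (Sum.Lex.inl_lt_inl_iff.2 hc) (Sum.Lex.inl_lt_inl_iff.2 hc')⟩
      obtain rfl : Order.succ a = a' := Order.succ_eq_of_covBy h'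
      exact Or.inl (t.step a h'.lt.not_isMax)
    · right
      have ha : IsTop a := fun c => le_of_not_gt fun hc =>
        h.2 (Sum.Lex.inl_lt_inl_iff.2 hc) (Sum.Lex.inl_lt_inr _ _)
      obtain rfl : b' = ⊥ := by
        by_contra hb
        exact h.2 (c := Sum.inrₗ ⊥) (Sum.Lex.inl_lt_inr _ _)
          (Sum.Lex.inr_lt_inr_iff.2 (bot_lt_iff_ne_bot.2 hb))
      have hT : IsTerminal a := IsTerminal.ofUniqueHom (fun c => homOfLE (ha c))
        (fun _ _ => Subsingleton.elim _ _)
      have : IsIso (t.ι.app a) := t.isColimit.isIso_ι_app_of_isTerminal a hT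
      change IsIso (t.ι.app a ≫ e.inv ≫ G.map _)
      rw [map_homOfLE_self]
      infer_instance
    · exact (Sum.Lex.not_inr_lt_inl h.lt).elim
    · have h' : b ⋖ b' := ⟨Sum.Lex.inr_lt_inr_iff.1 h.lt, fun c hc hc' =>
        h.2 (Sum.Lex.inr_lt_inr_iff.2 hc) (Sum.Lex.inr_lt_inr_iff.2 hc')⟩
      exact Or.inl (hGs b b' h')
  · rintro (a | b) hj
    · have ha : Order.IsSuccLimit a := by
        refine ⟨fun ha => hj.1 ?_, fun c hc => ?_⟩
        · rintro (c | c) hc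
          · exact Sum.Lex.inl_le_inl_iff.2 (ha (Sum.Lex.inl_le_inl_iff.1 hc))
          · exact (Sum.Lex.not_inr_le_inl hc).elim
        · refine hj.2 (Sum.inlₗ c) ⟨Sum.Lex.inl_lt_inl_iff.2 hc.lt, ?_⟩
          rintro (d | d) hd hd'
          · exact hc.2 (Sum.Lex.inl_lt_inl_iff.1 hd) (Sum.Lex.inl_lt_inl_iff.1 hd')
          · exact Sum.Lex.not_inr_lt_inl hd'
      intro W φ hφ
      obtain ⟨ψ, h₁, h₂⟩ := (smoothAt_iff t.F a).2 (t.smooth a ha) W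
        (fun i hi => φ (Sum.inlₗ i) (Sum.Lex.inl_lt_inl_iff.2 hi))
        (fun i i' h h' => hφ _ _ (Sum.Lex.inl_le_inl_iff.2 h) _)
      refine ⟨ψ, ?_, fun ψ' h => h₂ ψ' fun i hi => h (Sum.inlₗ i) (Sum.Lex.inl_lt_inl_iff.2 hi)⟩
      rintro (i | i) hi
      · exact h₁ i (Sum.Lex.inl_lt_inl_iff.1 hi)
      · exact (Sum.Lex.not_inr_lt_inl hi).elim
    · intro W φ hφ
      by_cases hb : b = ⊥
      · subst hb
        let s : Cocone t.F :=
          { pt := W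
            ι := { app := fun a => φ (Sum.inlₗ a) (Sum.Lex.inl_lt_inr _ _)
                   naturality := fun a a' h =>
                    (hφ _ _ (Sum.Lex.inl_le_inl_iff.2 (leOfHom h)) _).trans
                      (Category.comp_id _).symm } }
        refine ⟨e.hom ≫ t.isColimit.desc s, ?_, ?_⟩
        · rintro (i | i) hi
          · change (t.ι.app i ≫ e.inv ≫ G.map _) ≫ e.hom ≫ _ = _
            rw [map_homOfLE_self]
            refine Eq.trans ?_ (t.isColimit.fac s i)
            simp
          · exact (not_lt_bot (Sum.Lex.inr_lt_inr_iff.1 hi)).elim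
        · intro ψ hψ
          refine (Iso.inv_comp_eq e).1 (t.isColimit.uniq s _ fun i => ?_)
          refine Eq.trans ?_ (hψ (Sum.inlₗ i) (Sum.Lex.inl_lt_inr _ _))
          change t.ι.app i ≫ e.inv ≫ ψ = (t.ι.app i ≫ e.inv ≫ G.map _) ≫ ψ
          rw [map_homOfLE_self, Category.comp_id]
          exact (Category.assoc _ _ _).symm
      · have hb' : Order.IsSuccLimit b := by
          refine ⟨fun h => hb h.eq_bot, fun c hc => ?_⟩
          refine hj.2 (Sum.inrₗ c) ⟨Sum.Lex.inr_lt_inr_iff.2 hc.lt, ?_⟩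
          rintro (d | d) hd hd'
          · exact Sum.Lex.not_inr_lt_inl hd
          · exact hc.2 (Sum.Lex.inr_lt_inr_iff.1 hd) (Sum.Lex.inr_lt_inr_iff.1 hd')
        obtain ⟨ψ, h₁, h₂⟩ := hGl b hb' W
          (fun i hi => φ (Sum.inrₗ i) (Sum.Lex.inr_lt_inr_iff.2 hi))
          (fun i i' h h' => hφ _ _ (Sum.Lex.inr_le_inr_iff.2 h) _)
        refine ⟨ψ, ?_, fun ψ' h => h₂ ψ' fun i hi =>
          h (Sum.inrₗ i) (Sum.Lex.inr_lt_inr_iff.2 hi)⟩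
        rintro (i | i) hi
        · have hbot : (⊥ : B) < b := bot_lt_iff_ne_bot.2 hb
          refine Eq.trans ?_ (hφ (Sum.inlₗ i) (Sum.inrₗ ⊥) (Sum.Lex.inl_le_inr _ _)
            (Sum.Lex.inr_lt_inr_iff.2 hbot))
          change (t.ι.app i ≫ e.inv ≫ G.map _) ≫ _ = (t.ι.app i ≫ e.inv ≫ G.map _) ≫ _
          rw [← h₁ ⊥ hbot, map_homOfLE_self]
          simp
        · exact h₁ i (Sum.Lex.inr_lt_inr_iff.1 hi)

lemma isIso_map_of_isIso_covBy {J : Type*} [LinearOrder J] [WellFoundedLT J] (F : J ⥤ C)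
    (hl : ∀ j, Order.IsSuccLimit j → SmoothAt F j) {a b : J} (hab : a ≤ b)
    (h : ∀ c d (hcd : c ⋖ d), a ≤ c → d ≤ b → IsIso (F.map (homOfLE hcd.le))) :
    IsIso (F.map (homOfLE hab)) := by
  induction b using WellFoundedLT.induction with | _ b ih =>
  obtain rfl | hlt := hab.eq_or_lt
  · rw [map_homOfLE_self]
    infer_instance
  by_cases hb : ∃ c, c ⋖ b
  · obtain ⟨c, hc⟩ := hb
    have hac : a ≤ c := hc.le_of_lt hlt
    have := ih c hc.lt hac fun x y hxy hx hy => h x y hxy hx (hy.trans hc.le)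
    have := h c b hc hac le_rfl
    rw [← map_homOfLE_comp F hac hc.le]
    infer_instance
  · have hb' : Order.IsSuccLimit b := ⟨fun hm => hlt.not_ge (hm hlt.le), fun c hc => hb ⟨c, hc⟩⟩
    have hiso : ∀ i (_ : i < b), IsIso (F.map (homOfLE (le_max_right i a))) := fun i hi =>
      ih _ (max_lt hi hlt) _ fun x y hxy hx hy => h x y hxy hx (hy.trans (max_lt hi hlt).le)
    obtain ⟨ψ, hψ, -⟩ := hl b hb' (F.obj a)
      (fun i hi => F.map (homOfLE (le_max_left i a)) ≫
        haveI := hiso i hi; inv (F.map (homOfLE (le_max_right i a)))) (by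
          intro i i' hi hi'
          have h₁ := hiso i' hi'
          have h₂ := hiso i (hi.trans_lt hi')
          rw [map_homOfLE_comp_assoc, IsIso.comp_inv_eq, Category.assoc, eq_comm,
            ← map_homOfLE_comp F (le_max_right i a) (max_le_max_right a hi),
            IsIso.inv_hom_id_assoc, map_homOfLE_comp])
    have h₁ : F.map (homOfLE hab) ≫ ψ = 𝟙 _ := by
      have := hiso a hlt
      rw [hψ a hlt]
      rw [IsIso.comp_inv_eq, Category.id_comp]
    refine ⟨ψ, h₁, ?_⟩
    obtain ⟨_, -, hu⟩ := hl b hb' (F.obj b) (fun i hi => F.map (homOfLE hi.le))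
      (fun i i' hi hi' => map_homOfLE_comp F _ _)
    refine (hu _ fun i hi => ?_).trans (hu _ fun i hi => Category.comp_id _).symm
    have := hiso i hi
    rw [← Category.assoc, hψ i hi]
    rw [Category.assoc]
    rw [← map_homOfLE_comp F (le_max_right i a) (max_lt hi hlt).le, IsIso.inv_hom_id_assoc,
      map_homOfLE_comp]

/-- Isomorphisms can be removed from transfinite compositions. -/
lemma HasTower.of_sup_isomorphisms {P : MorphismProperty C} [P.RespectsIso] {X Y : C}
    {f : X ⟶ Y} (h : HasTower (P ⊔ MorphismProperty.isomorphisms C) f) : HasTower P f := by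
  obtain ⟨J, _, _, _, F, e, e', hf, hs, hl⟩ := h
  let T : Set J := {a | a = ⊤ ∨ ∃ b, ∃ h : a ⋖ b, ¬ IsIso (F.map (homOfLE h.le))}
  have hT : ∀ {a b : J} (hab : a ≤ b), (∀ c ∈ T, a ≤ c → b ≤ c) →
      IsIso (F.map (homOfLE hab)) := fun hab h =>
    isIso_map_of_isIso_covBy F hl hab fun c d hcd hac hdb => by
      by_contra hc
      exact ((h c (Or.inr ⟨d, hcd, hc⟩) hac).trans_lt hcd.lt).not_ge hdb
  have : Nonempty T := ⟨⟨⊤, Or.inl rfl⟩⟩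
  let _ : OrderBot T := WellFoundedLT.toOrderBot T
  let _ : OrderTop T := { top := ⟨⊤, Or.inl rfl⟩, le_top := fun a => le_top (a := a.1) }
  let _ : BoundedOrder T := {}
  let G : T ⥤ C :=
    { obj := fun a => F.obj a.1
      map := fun f => F.map (homOfLE (leOfHom f))
      map_id := fun a => F.map_id a.1
      map_comp := fun f g => (map_homOfLE_comp F (leOfHom f) (leOfHom g)).symm }
  have hG : ∀ (a b : T) (h : a ≤ b), G.map (homOfLE h) = F.map (homOfLE h) := fun _ _ _ => rfl
  have hbot : IsIso (F.map (homOfLE (bot_le : ⊥ ≤ (⊥ : T).1))) :=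
    hT _ fun c hc _ => show (⊥ : T) ≤ ⟨c, hc⟩ from bot_le
  refine ⟨T, inferInstance, inferInstance, inferInstance, G,
    (asIso (F.map (homOfLE (bot_le : ⊥ ≤ (⊥ : T).1)))).symm ≪≫ e, e', ?_, ?_, ?_⟩
  · rw [hf, hG]
    simp only [Iso.trans_inv, Iso.symm_inv, asIso_hom, Category.assoc]
    congr 1
    exact (map_homOfLE_comp_assoc F (bot_le : ⊥ ≤ (⊥ : T).1) le_top _).symm
  · intro a b hab
    obtain ha | ⟨c, hac, hc⟩ := a.2
    · exact (hab.lt.not_ge (show b.1 ≤ a.1 from ha ▸ le_top)).elim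
    have hcb : c ≤ b.1 := hac.ge_of_gt hab.lt
    have : IsIso (F.map (homOfLE hcb)) := hT hcb fun d hd hcd =>
      hab.ge_of_gt (show a < ⟨d, hd⟩ from hac.lt.trans_le hcd)
    rw [hG, ← map_homOfLE_comp F hac.le hcb]
    exact MorphismProperty.RespectsIso.postcomp P _ _ ((hs a c hac).resolve_right hc)
  · intro x hx
    have hub : ∃ u : J, ∀ y : T, y < x → y.1 ≤ u := ⟨x, fun y hy => hy.le⟩
    obtain ⟨u, hu, hmin⟩ := WellFounded.has_min (wellFounded_lt (α := J)) _ hub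
    have hu' : ∀ i < u, ∃ y : T, y < x ∧ i < y.1 := fun i hi => by
      by_contra! hcon
      exact hmin i hcon hi
    have hnext : ∀ y : T, y < x → ∃ z : T, y < z ∧ z < x := fun y hy => by
      by_contra! hcon
      exact hx.2 y ⟨hy, fun z hz => (hcon z hz).not_gt⟩
    have hlt : ∀ y : T, y < x → y.1 < u := fun y hy => by
      obtain ⟨z, hz, hzx⟩ := hnext y hy
      exact lt_of_lt_of_le hz (hu z hzx)
    have hul : Order.IsSuccLimit u := by
      refine ⟨fun hm => ?_, fun c hc => ?_⟩
      · refine hx.1 fun y hy => le_of_not_gt fun hyx => ?_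
        exact (hlt y (hy.lt_of_ne hyx.ne)).not_ge (hm (hlt y hyx).le)
      · obtain ⟨y, hy, hcy⟩ := hu' c hc.lt
        exact hc.2 hcy (hlt y hy)
    have hux : u ≤ x.1 := le_of_not_gt fun h => hmin x.1 (fun y hy => hy.le) h
    have hiso : IsIso (F.map (homOfLE hux)) := hT hux fun c hc huc => le_of_not_gt fun hcx =>
      (hlt ⟨c, hc⟩ hcx).not_ge huc
    intro Z φ hφ
    choose! y hy hiy using hu'
    obtain ⟨ψ, h₁, h₂⟩ := hl u hul Z
      (fun i hi => F.map (homOfLE (hiy i hi).le) ≫ φ (y i) (hy i hi)) (by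
        intro i i' hi hi'
        have hi₀ := hi.trans_lt hi'
        rw [map_homOfLE_comp_assoc]
        obtain h | h := le_total (y i) (y i')
        · rw [← hφ _ _ h (hy i' hi'), hG, map_homOfLE_comp_assoc]
        · rw [← hφ _ _ h (hy i hi₀), hG, map_homOfLE_comp_assoc])
    have hψ : ∀ (t : T) (ht : t < x), F.map (homOfLE (hlt t ht).le) ≫ ψ = φ t ht := by
      intro t ht
      rw [h₁ t (hlt t ht)]
      exact hφ t _ (hiy t (hlt t ht)).le (hy t (hlt t ht))
    refine ⟨inv (F.map (homOfLE hux)) ≫ ψ, fun t ht => ?_, fun ψ' hψ' => ?_⟩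
    · rw [hG, ← map_homOfLE_comp F (hlt t ht).le hux, Category.assoc, IsIso.hom_inv_id_assoc, hψ]
    · rw [IsIso.eq_inv_comp]
      refine h₂ _ fun i hi => ?_
      rw [← hψ' _ (hy i hi), hG]
      simp only [map_homOfLE_comp_assoc]

end Towers

instance {C : Type u} [Category.{v} C] (K : MorphismProperty C) :
    MorphismProperty.IsStableUnderCobaseChange (pushoutsOf K) where
  of_isPushout := by
    rintro _ _ _ _ _ _ _ _ sq ⟨A, B, k, u, w, hk, hp⟩
    exact ⟨A, B, k, _, _, hk, hp.paste_horiz sq⟩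

lemma pushoutsOf_mono {C : Type u} [Category.{v} C] {K L : MorphismProperty C} (h : K ≤ L) :
    pushoutsOf K ≤ pushoutsOf L := by
  rintro _ _ _ ⟨A, B, g, u, w, hg, hp⟩
  exact ⟨A, B, g, u, w, h _ hg, hp⟩

lemma relativeCellComplexes_iff_hasTower {C : Type u} [Category.{v} C] {K : MorphismProperty C}
    {X Y : C} (f : X ⟶ Y) : relativeCellComplexes K f ↔ HasTower (pushoutsOf K) f := by
  refine ⟨fun h => ?_, HasTower.transfiniteCompositions⟩
  have := (HasTower.transfiniteCompositions_comp h (hasTower_id _ Y)).of_sup_isomorphisms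
  rwa [Category.comp_id] at this

lemma isPushout_of_existsUnique {C : Type u} [Category.{v} C] {A B X Y : C} {u : A ⟶ X}
    {g : A ⟶ B} {f : X ⟶ Y} {w : B ⟶ Y} (hw : u ≫ f = g ≫ w)
    (h : ∀ (Z : C) (x : X ⟶ Z) (y : B ⟶ Z), u ≫ x = g ≫ y →
      ∃! d : Y ⟶ Z, f ≫ d = x ∧ w ≫ d = y) : IsPushout u g f w :=
  ⟨⟨hw⟩, ⟨PushoutCocone.IsColimit.mk hw
    (fun s => (h s.pt s.inl s.inr s.condition).choose)
    (fun s => (h s.pt s.inl s.inr s.condition).choose_spec.1.1)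
    (fun s => (h s.pt s.inl s.inr s.condition).choose_spec.1.2)
    (fun s m h₁ h₂ => (h s.pt s.inl s.inr s.condition).choose_spec.2 m ⟨h₁, h₂⟩)⟩⟩

section CoproductInclusion

variable {C : Type u} [Category.{v} C] [HasBinaryCoproducts C] [HasCoproducts.{v} C]

/-- The object `X ⊔ U^(A)`. -/
noncomputable def adjoin (X U : C) {S : Type v} (A : Set S) : C := X ⨿ ∐ fun _ : A => U

namespace adjoin

variable (X U : C) {S : Type v}

/-- The inclusion of `X`. -/
noncomputable def inl (A : Set S) : X ⟶ adjoin X U A := coprod.inl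

/-- The inclusion of the copy of `U` indexed by `s`. -/
noncomputable def leg (A : Set S) (s : S) (hs : s ∈ A) : U ⟶ adjoin X U A :=
  Sigma.ι (fun _ : A => U) ⟨s, hs⟩ ≫ coprod.inr

variable {X U}

/-- The map out of `X ⊔ U^(A)` with given components. -/
noncomputable def desc {A : Set S} {Z : C} (a : X ⟶ Z) (b : ∀ s ∈ A, U ⟶ Z) :
    adjoin X U A ⟶ Z :=
  coprod.desc a (Sigma.desc fun s => b s.1 s.2)

@[simp]
lemma inl_desc {A : Set S} {Z : C} (a : X ⟶ Z) (b : ∀ s ∈ A, U ⟶ Z) :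
    inl X U A ≫ desc a b = a :=
  coprod.inl_desc _ _

@[simp]
lemma leg_desc {A : Set S} {Z : C} (a : X ⟶ Z) (b : ∀ s ∈ A, U ⟶ Z) (s : S) (hs : s ∈ A) :
    leg X U A s hs ≫ desc a b = b s hs :=
  (Category.assoc _ _ _).trans
    ((congrArg _ (coprod.inr_desc _ _)).trans (Sigma.ι_desc _ _))

lemma hom_ext {A : Set S} {Z : C} {f g : adjoin X U A ⟶ Z} (h : inl X U A ≫ f = inl X U A ≫ g)
    (h' : ∀ s hs, leg X U A s hs ≫ f = leg X U A s hs ≫ g) : f = g := by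
  refine coprod.hom_ext h (Sigma.hom_ext _ _ fun s => ?_)
  exact (Category.assoc _ _ _).symm.trans ((h' s.1 s.2).trans (Category.assoc _ _ _))

variable (X U)

/-- The inclusion of `X ⊔ U^(A)` in `X ⊔ U^(B)` for `A ⊆ B`. -/
noncomputable def map {A B : Set S} (h : A ⊆ B) : adjoin X U A ⟶ adjoin X U B :=
  desc (inl X U B) fun s hs => leg X U B s (h hs)

@[simp]
lemma inl_map {A B : Set S} (h : A ⊆ B) : inl X U A ≫ map X U h = inl X U B :=
  inl_desc _ _

@[simp]
lemma leg_map {A B : Set S} (h : A ⊆ B) (s : S) (hs : s ∈ A) :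
    leg X U A s hs ≫ map X U h = leg X U B s (h hs) :=
  leg_desc _ _ _ _

@[simp]
lemma map_map {A B D : Set S} (h : A ⊆ B) (h' : B ⊆ D) :
    map X U h ≫ map X U h' = map X U (h.trans h') :=
  hom_ext (by rw [← Category.assoc]; simp) fun s hs => by rw [← Category.assoc]; simp

@[simp]
lemma map_self {A : Set S} (h : A ⊆ A) : map X U h = 𝟙 _ :=
  hom_ext (by simp) fun s hs => by simp

lemma isIso_inl {A : Set S} (hA : ∀ s, s ∉ A) : IsIso (inl X U A) :=
  ⟨desc (𝟙 X) fun s hs => (hA s hs).elim, by simp, hom_ext (by rw [← Category.assoc]; simp)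
    fun s hs => (hA s hs).elim⟩

lemma isPushout_map [HasInitial C] {A B : Set S} (h : A ⊆ B) (s : S) (hs : s ∈ B) (hsA : s ∉ A)
    (hB : ∀ t ∈ B, t ∈ A ∨ t = s) :
    IsPushout (initial.to _) (initial.to U) (map X U h) (leg X U B s hs) := by
  classical
  refine isPushout_of_existsUnique (Subsingleton.elim _ _) fun Z x y _ => ?_
  have hd : leg X U B s hs ≫ desc (inl X U A ≫ x)
      (fun t _ => if h : t ∈ A then leg X U A t h ≫ x else y) = y := by simp [hsA]
  refine ⟨_, ⟨hom_ext ?_ fun t ht => ?_, hd⟩, ?_⟩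
  · rw [← Category.assoc, inl_map, inl_desc]
  · rw [← Category.assoc, leg_map, leg_desc, dif_pos ht]
  · rintro d ⟨rfl, rfl⟩
    refine hom_ext ?_ fun t ht => ?_
    · rw [inl_desc, ← Category.assoc, inl_map]
    · obtain htA | rfl := hB t ht
      · rw [leg_desc, dif_pos htA, ← Category.assoc, leg_map]
      · rw [leg_desc, dif_neg hsA]

lemma inl_map_assoc {A B : Set S} (h : A ⊆ B) {Z : C} (d : adjoin X U B ⟶ Z) :
    inl X U A ≫ map X U h ≫ d = inl X U B ≫ d := by
  rw [← Category.assoc, inl_map]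

lemma leg_map_assoc {A B : Set S} (h : A ⊆ B) (s : S) (hs : s ∈ A) {Z : C}
    (d : adjoin X U B ⟶ Z) : leg X U A s hs ≫ map X U h ≫ d = leg X U B s (h hs) ≫ d := by
  rw [← Category.assoc, leg_map]

/-- The initial segment of `S` consisting of the elements below `j`. -/
def below [LinearOrder S] (j : WithTop S) : Set S := {s | (s : WithTop S) < j}

lemma below_mono [LinearOrder S] {i j : WithTop S} (h : i ≤ j) : below i ⊆ below j :=
  fun _ hs => lt_of_lt_of_le hs h

/-- The sequence adjoining copies of `U` to `X` one at a time. -/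
noncomputable def functor (S : Type v) [LinearOrder S] : WithTop S ⥤ C where
  obj j := adjoin X U (below j)
  map f := map X U (below_mono (leOfHom f))
  map_id _ := map_self _ _ _
  map_comp _ _ := (map_map _ _ _ _).symm

lemma smoothAt_functor {S : Type v} [LinearOrder S] {j : WithTop S} (hj : Order.IsSuccLimit j) :
    SmoothAt (functor X U S) j := by
  intro Z φ hφ
  change ∀ i, i < j → (adjoin X U (below i) ⟶ Z) at φ
  change ∃! ψ : adjoin X U (below j) ⟶ Z, ∀ i (hi : i < j), map X U (below_mono hi.le) ≫ ψ = φ i hi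
  replace hφ : ∀ i k (hik : i ≤ k) (hk : k < j),
    map X U (below_mono hik) ≫ φ k hk = φ i (hik.trans_lt hk) := hφ
  have hnext : ∀ i < j, ∃ k, i < k ∧ k < j := fun i hi => by
    by_contra! hcon
    exact hj.2 i ⟨hi, fun k hk => (hcon k hk).not_gt⟩
  choose! n hn hnj using hnext
  obtain ⟨i₀, hi₀⟩ : ∃ i, i < j := by
    by_contra! hcon
    exact hj.1 fun i _ => hcon i
  have hinl : ∀ i hi, inl X U (below i) ≫ φ i hi = inl X U (below i₀) ≫ φ i₀ hi₀ := by
    have : ∀ i k (hik : i ≤ k) hk, inl X U _ ≫ φ k hk = inl X U _ ≫ φ i (hik.trans_lt hk) := by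
      intro i k hik hk
      rw [← hφ i k hik hk, inl_map_assoc]
    intro i hi
    obtain h | h := le_total i i₀
    · exact (this _ _ h _).symm
    · exact this _ _ h _
  have hleg : ∀ (s : S) i hi (hs : s ∈ below i), leg X U _ s hs ≫ φ i hi =
      leg X U (below (n s)) s (hn s (lt_trans hs hi)) ≫ φ (n s) (hnj s (lt_trans hs hi)) := by
    have : ∀ (s : S) i k (hik : i ≤ k) hk (hs : s ∈ below i),
        leg X U _ s (below_mono hik hs) ≫ φ k hk = leg X U _ s hs ≫ φ i (hik.trans_lt hk) := by
      intro s i k hik hk hs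
      rw [← hφ i k hik hk, leg_map_assoc]
    intro s i hi hs
    obtain h | h := le_total i (n s)
    · exact (this s _ _ h _ hs).symm
    · exact this s _ _ h _ _
  refine ⟨desc (inl X U (below i₀) ≫ φ i₀ hi₀)
    (fun s hs => leg X U (below (n s)) s (hn s hs) ≫ φ (n s) (hnj s hs)),
    fun i hi => hom_ext ?_ fun s hs => ?_, fun ψ hψ => hom_ext ?_ fun s hs => ?_⟩
  · rw [inl_map_assoc, inl_desc, hinl i hi]
  · rw [leg_map_assoc, leg_desc, hleg]
  · rw [inl_desc, ← hψ i₀ hi₀, inl_map_assoc]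
  · rw [leg_desc, ← hψ _ (hnj s hs)]
    exact (leg_map_assoc X U (below_mono (hnj s hs).le) s (hn s hs) ψ).symm

end adjoin

lemma hasTower_coprod_inl [HasInitial C] {K : MorphismProperty C} (X U : C)
    (hU : K (initial.to U)) (S : Type v) :
    HasTower (pushoutsOf K) (coprod.inl : X ⟶ X ⨿ ∐ fun _ : S => U) := by
  obtain ⟨_, _⟩ := exists_wellFoundedLT S
  let _ : OrderBot (WithTop S) := WellFoundedLT.toOrderBot (WithTop S)
  have : IsIso (adjoin.inl X U (adjoin.below (⊥ : WithTop S))) :=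
    adjoin.isIso_inl X U fun s hs => not_lt_bot (show (s : WithTop S) < ⊥ from hs)
  let e : adjoin X U (adjoin.below (⊤ : WithTop S)) ≅ X ⨿ ∐ fun _ : S => U :=
    coprod.mapIso (Iso.refl X)
      (Sigma.whiskerEquiv (Equiv.subtypeUnivEquiv WithTop.coe_lt_top) fun _ => Iso.refl U)
  have he : adjoin.inl X U _ ≫ e.hom = coprod.inl :=
    (coprod.inl_map _ _).trans (Category.id_comp _)
  refine ⟨WithTop S, inferInstance, {}, inferInstance, adjoin.functor X U S,
    (asIso (adjoin.inl X U (adjoin.below ⊥))).symm, e, ?_, ?_,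
    fun j => adjoin.smoothAt_functor X U⟩
  · exact he.symm.trans (adjoin.inl_map_assoc X U (adjoin.below_mono bot_le) e.hom).symm
  · intro a b hab
    obtain ⟨s, rfl⟩ := WithTop.ne_top_iff_exists.1 (hab.lt.trans_le le_top).ne
    refine ⟨_, _, _, _, _, hU, adjoin.isPushout_map X U (adjoin.below_mono hab.le) s hab.lt
      (fun h => lt_irrefl (s : WithTop S) h) fun t ht => ?_⟩
    obtain h | h := lt_or_ge (t : WithTop S) s
    · exact Or.inl h
    · refine Or.inr (le_antisymm ?_ (WithTop.coe_le_coe.1 h))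
      exact WithTop.coe_le_coe.1 (hab.le_of_lt ht)

end CoproductInclusion

section FreeCells

variable {C : Type u} [Category.{v} C] [HasInitial C]

/-- A set of steps `F.obj s ⟶ F.obj (target s)` of a sequence `F` which are coproduct inclusions with
complement `U`. -/
structure FreeCells {J : Type v} [LinearOrder J] (F : J ⥤ C) (U : C) where
  source : Set J
  target : source → J
  covBy (s : source) : s.1 ⋖ target s
  attach (s : source) : U ⟶ F.obj (target s)
  isPushout (s : source) : IsPushout (initial.to (F.obj s.1)) (initial.to U)
    (F.map (homOfLE (covBy s).le)) (attach s)

namespace FreeCells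

variable {J : Type v} [LinearOrder J] {F : J ⥤ C} {U : C} (D : FreeCells F U)

lemma target_le_of_lt {s : D.source} {j : J} (h : s.1 < j) : D.target s ≤ j :=
  (D.covBy s).ge_of_gt h

lemma target_le_of_le_of_covBy {s : D.source} {j k : J} (hjk : j ⋖ k) (hs : s.1 ≠ j)
    (h : D.target s ≤ k) : D.target s ≤ j :=
  D.target_le_of_lt ((hjk.le_of_lt ((D.covBy s).lt.trans_le h)).lt_of_ne hs)

/-- The cells which have not been attached yet at stage `j`. -/
def remaining (j : J) : Set D.source := {s | j ≤ s.1}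

variable [HasBinaryCoproducts C] [HasCoproducts.{v} C]

/-- The `j`-th stage of the sequence obtained from `F` by attaching all free cells at the start. -/
noncomputable abbrev stage (j : J) : C := adjoin (F.obj j) U (D.remaining j)

/-- The inclusion of `F.obj j` in the `j`-th stage. -/
noncomputable abbrev inl (j : J) : F.obj j ⟶ D.stage j := adjoin.inl _ _ _

open Classical in
/-- The inclusion of the cell `s` into the `j`-th stage. -/
noncomputable def cell (j : J) (s : D.source) : U ⟶ D.stage j :=
  if h : j ≤ s.1 then adjoin.leg _ _ _ s h
  else D.attach s ≫ F.map (homOfLE (D.target_le_of_lt (not_le.1 h))) ≫ D.inl j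

variable {D}

lemma cell_of_le {j : J} {s : D.source} (h : j ≤ s.1) : D.cell j s = adjoin.leg _ _ _ s h :=
  dif_pos h

lemma cell_of_target_le {j : J} {s : D.source} (h : D.target s ≤ j) :
    D.cell j s = D.attach s ≫ F.map (homOfLE h) ≫ D.inl j :=
  dif_neg ((D.covBy s).lt.trans_le h).not_ge

lemma hom_ext {j : J} {Z : C} {f g : D.stage j ⟶ Z} (h : D.inl j ≫ f = D.inl j ≫ g)
    (h' : ∀ s, D.cell j s ≫ f = D.cell j s ≫ g) : f = g :=
  adjoin.hom_ext h fun s hs => by rw [← cell_of_le hs, h']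

lemma exists_desc {j : J} {Z : C} (a : F.obj j ⟶ Z) (b : D.source → (U ⟶ Z))
    (hab : ∀ s (h : D.target s ≤ j), D.attach s ≫ F.map (homOfLE h) ≫ a = b s) :
    ∃ d : D.stage j ⟶ Z, D.inl j ≫ d = a ∧ ∀ s, D.cell j s ≫ d = b s := by
  refine ⟨adjoin.desc a fun s _ => b s, adjoin.inl_desc _ _, fun s => ?_⟩
  obtain h | h := le_or_gt j s.1
  · rw [cell_of_le h]
    exact adjoin.leg_desc _ _ _ _
  · rw [cell_of_target_le (D.target_le_of_lt h), Category.assoc, Category.assoc, adjoin.inl_desc,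
      hab]

variable (D)

/-- The transition maps between stages. -/
noncomputable def map {j k : J} (h : j ≤ k) : D.stage j ⟶ D.stage k :=
  adjoin.desc (F.map (homOfLE h) ≫ D.inl k) fun s _ => D.cell k s

lemma inl_map {j k : J} (h : j ≤ k) : D.inl j ≫ D.map h = F.map (homOfLE h) ≫ D.inl k :=
  adjoin.inl_desc _ _

lemma cell_map {j k : J} (h : j ≤ k) (s : D.source) : D.cell j s ≫ D.map h = D.cell k s := by
  obtain hs | hs := le_or_gt j s.1
  · rw [cell_of_le hs]
    exact adjoin.leg_desc _ _ _ _
  · have hs' := D.target_le_of_lt hs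
    rw [cell_of_target_le hs', cell_of_target_le (hs'.trans h), Category.assoc, Category.assoc,
      inl_map, map_homOfLE_comp_assoc]

lemma inl_map_assoc {j k : J} (h : j ≤ k) {Z : C} (d : D.stage k ⟶ Z) :
    D.inl j ≫ D.map h ≫ d = F.map (homOfLE h) ≫ D.inl k ≫ d := by
  rw [← Category.assoc, inl_map, Category.assoc]

lemma cell_map_assoc {j k : J} (h : j ≤ k) (s : D.source) {Z : C} (d : D.stage k ⟶ Z) :
    D.cell j s ≫ D.map h ≫ d = D.cell k s ≫ d := by
  rw [← Category.assoc, cell_map]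

/-- The sequence obtained from `F` by attaching all free cells at the start. -/
noncomputable def functor : J ⥤ C where
  obj := D.stage
  map f := D.map (leOfHom f)
  map_id j := hom_ext
    (by rw [inl_map, map_homOfLE_self, Category.id_comp, Category.comp_id])
    fun s => by rw [cell_map, Category.comp_id]
  map_comp f g := hom_ext
    (by rw [inl_map_assoc, inl_map, inl_map, map_homOfLE_comp_assoc])
    fun s => by rw [cell_map_assoc, cell_map, cell_map]

lemma smoothAt_functor [OrderBot J] {k : J} (hk : Order.IsSuccLimit k) (hF : SmoothAt F k) :
    SmoothAt D.functor k := by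
  intro Z φ hφ
  change ∀ i, i < k → (D.stage i ⟶ Z) at φ
  change ∃! ψ : D.stage k ⟶ Z, ∀ i (hi : i < k), D.map hi.le ≫ ψ = φ i hi
  replace hφ : ∀ i j (hij : i ≤ j) (hj : j < k), D.map hij ≫ φ j hj = φ i (hij.trans_lt hj) := hφ
  obtain ⟨a, ha, hau⟩ := hF Z (fun i hi => D.inl i ≫ φ i hi) fun i j hij hj => by
    rw [← hφ i j hij hj, inl_map_assoc]
  have hbot : ⊥ < k := bot_lt_iff_ne_bot.2 fun h => hk.1 (h ▸ isMin_bot)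
  have hcell : ∀ i hi s, D.cell i s ≫ φ i hi = D.cell ⊥ s ≫ φ ⊥ hbot := fun i hi s => by
    rw [← hφ ⊥ i bot_le hi, cell_map_assoc]
  obtain ⟨ψ, h₁, h₂⟩ := exists_desc (D := D) a (fun s => D.cell ⊥ s ≫ φ ⊥ hbot) fun s h => by
    have ht : D.target s < k := h.lt_of_ne fun h' => hk.2 s.1 (h' ▸ D.covBy s)
    rw [ha _ ht, ← hcell _ ht, cell_of_target_le le_rfl, map_homOfLE_self, Category.id_comp,
      Category.assoc]
  refine ⟨ψ, fun i hi => hom_ext ?_ fun s => ?_, fun ψ' hψ' => hom_ext ?_ fun s => ?_⟩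
  · rw [inl_map_assoc, h₁, ha]
  · rw [cell_map_assoc, h₂, hcell i hi]
  · rw [h₁]
    exact hau _ fun i hi => by rw [← inl_map_assoc, hψ' i hi]
  · rw [h₂, ← hψ' ⊥ hbot, cell_map_assoc]

lemma isIso_map {j k : J} (hjk : j ⋖ k) (hj : j ∈ D.source) : IsIso (D.map hjk.le) := by
  let s : D.source := ⟨j, hj⟩
  obtain rfl : D.target s = k := (D.covBy s).unique_right hjk
  have hp := D.isPushout s
  let p : F.obj (D.target s) ⟶ D.stage j := hp.desc (D.inl j) (D.cell j s) (Subsingleton.elim _ _)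
  have hp₁ : F.map (homOfLE hjk.le) ≫ p = D.inl j := hp.inl_desc _ _ _
  have hp₂ : D.attach s ≫ p = D.cell j s := hp.inr_desc _ _ _
  obtain ⟨d, h₁, h₂⟩ := exists_desc (D := D) p (fun s' => D.cell j s') fun s' h => by
    by_cases hs : s' = s
    · subst hs
      rw [map_homOfLE_self, Category.id_comp, hp₂]
    · have hs' := D.target_le_of_le_of_covBy hjk (fun h' => hs (Subtype.ext h')) h
      rw [cell_of_target_le hs', ← map_homOfLE_comp F hs' hjk.le, Category.assoc, hp₁]
  refine ⟨d, hom_ext ?_ fun s' => ?_, hom_ext ?_ fun s' => ?_⟩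
  · rw [inl_map_assoc, h₁, hp₁, Category.comp_id]
  · rw [cell_map_assoc, h₂, Category.comp_id]
  · rw [← Category.assoc, h₁, Category.comp_id]
    refine hp.hom_ext ?_ ?_
    · rw [← Category.assoc, hp₁, inl_map]
    · rw [← Category.assoc, hp₂, cell_map, cell_of_target_le le_rfl, map_homOfLE_self,
        Category.id_comp]
  · rw [← Category.assoc, h₂, cell_map, Category.comp_id]

lemma isPushout_map {j k : J} (hjk : j ⋖ k) (hj : j ∉ D.source) :
    IsPushout (D.inl j) (F.map (homOfLE hjk.le)) (D.map hjk.le) (D.inl k) := by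
  refine isPushout_of_existsUnique (D.inl_map _) fun Z x y hxy => ?_
  obtain ⟨d, h₁, h₂⟩ := exists_desc (D := D) y (fun s => D.cell j s ≫ x) fun s h => by
    have hs := D.target_le_of_le_of_covBy hjk (fun h' => hj (h' ▸ s.2)) h
    rw [cell_of_target_le hs, ← map_homOfLE_comp F hs hjk.le, Category.assoc, ← hxy,
      Category.assoc, Category.assoc]
  refine ⟨d, ⟨hom_ext ?_ fun s => ?_, h₁⟩, ?_⟩
  · rw [inl_map_assoc, h₁, hxy]
  · rw [cell_map_assoc, h₂]
  · rintro d' ⟨rfl, h⟩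
    refine hom_ext (h.trans h₁.symm) fun s => ?_
    rw [h₂, cell_map_assoc]

lemma isIso_inl_top [OrderTop J] : IsIso (D.inl ⊤) :=
  adjoin.isIso_inl _ _ fun s hs => ((D.covBy s).lt.trans_le le_top).not_ge hs

end FreeCells

/-- A transfinite composition of maps which are either in `P` or coproduct inclusions with
complement `U` can be rearranged so that the coproduct inclusions come first. -/
lemma HasTower.exists_eq_coprod_inl_comp [HasBinaryCoproducts C] [HasCoproducts.{v} C] {U : C}
    {P Q : MorphismProperty C} [P.IsStableUnderCobaseChange]
    (hQ : ∀ {X Y : C} (f : X ⟶ Y), Q f →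
      P f ∨ ∃ w, IsPushout (initial.to X) (initial.to U) f w)
    {X Y : C} {f : X ⟶ Y} (h : HasTower Q f) :
    ∃ (S : Type v) (g : (X ⨿ ∐ fun _ : S => U) ⟶ Y),
      HasTower (P ⊔ MorphismProperty.isomorphisms C) g ∧ f = coprod.inl ≫ g := by
  obtain ⟨J, _, _, _, F, e, e', rfl, hs, hl⟩ := h
  let S : Set J := {s | ∃ (t : J) (h : s ⋖ t) (w : U ⟶ F.obj t),
    IsPushout (initial.to (F.obj s)) (initial.to U) (F.map (homOfLE h.le)) w}
  choose t ht w hw using fun s : S => s.2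
  let D : FreeCells F U := ⟨S, t, ht, w, hw⟩
  have : IsIso (D.inl ⊤) := D.isIso_inl_top
  let ε : D.stage ⊥ ≅ X ⨿ ∐ fun _ : D.remaining ⊥ => U := coprod.mapIso e (Iso.refl _)
  have hε : coprod.inl ≫ ε.inv = e.inv ≫ D.inl ⊥ := coprod.inl_map _ _
  refine ⟨D.remaining ⊥, ε.inv ≫ D.map bot_le ≫ inv (D.inl ⊤) ≫ e'.hom,
    ⟨J, _, _, ‹_›, D.functor, ε, (asIso (D.inl ⊤)).symm ≪≫ e', rfl, fun a b hab => ?_,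
      fun j hj => D.smoothAt_functor hj (hl j hj)⟩, ?_⟩
  · by_cases ha : a ∈ D.source
    · exact Or.inr (D.isIso_map hab ha)
    · obtain hP | ⟨w, hw⟩ := hQ _ (hs a b hab)
      · exact Or.inl (P.of_isPushout (D.isPushout_map hab ha) hP)
      · exact (ha ⟨b, hab, w, hw⟩).elim
  · rw [← Category.assoc coprod.inl, hε, Category.assoc, FreeCells.inl_map_assoc,
      IsIso.hom_inv_id_assoc]

end FreeCells

lemma pushoutsOf_tildeI {C : Type u} [Category.{v} C] [MonoidalCategory C] [HasInitial C]
    {I : MorphismProperty C} {X Y : C} (f : X ⟶ Y) (hf : pushoutsOf (tildeI I) f) :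
    pushoutsOf I f ∨ ∃ w, IsPushout (initial.to X) (initial.to (𝟙_ C)) f w := by
  obtain ⟨A, B, g, u, w, hg | hg, hp⟩ := hf
  · exact Or.inl ⟨A, B, g, u, w, hg, hp⟩
  · obtain rfl : A = ⊥_ C := congrArg Comma.left hg
    obtain rfl : B = 𝟙_ C := congrArg Comma.right hg
    obtain rfl : g = initial.to (𝟙_ C) := Subsingleton.elim _ _
    obtain rfl : u = initial.to X := Subsingleton.elim _ _
    exact Or.inr ⟨w, hp⟩

end Muro

namespace Muro

/-- **Lemma 10 of the paper.** In a cofibrantly generated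
monoidal model category with generating cofibrations `I`, a map `X ⟶ Y` is a
relative `Ĩ`-cell complex, for `Ĩ = I ∪ {∅ ⟶ 𝟙}`, if and only if it factors
as `X ⟶ X ⊔ 𝟙^(S) ⟶ Y` where `𝟙^(S)` is a coproduct of copies of `𝟙`
indexed by a set `S`, the first arrow is the inclusion of the first factor of
the coproduct, and the second arrow is a relative `I`-cell complex. -/
theorem relative_tildeI_cell_iff {C : Type u} [Category.{v} C]
    [MonoidalCategory C] [HasInitial C] [HasPushouts C]
    [HasBinaryCoproducts C] [HasCoproducts.{v} C]
    (M : ModelStructure C) (pp : PushoutProductAxiom M) (ua : UnitAxiom M)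
    (I Jg : MorphismProperty C) (cg : CofibrantlyGeneratedBy M I Jg)
    {X Y : C} (f : X ⟶ Y) :
    relativeCellComplexes (tildeI I) f ↔
      ∃ (S : Type v) (g : (X ⨿ ∐ (fun _ : S => 𝟙_ C)) ⟶ Y),
        relativeCellComplexes I g ∧ f = coprod.inl ≫ g := by
  rw [relativeCellComplexes_iff_hasTower]
  constructor
  · intro hf
    obtain ⟨S, g, hg, h⟩ := hf.exists_eq_coprod_inl_comp (P := pushoutsOf I) pushoutsOf_tildeI
    exact ⟨S, g, hg.of_sup_isomorphisms.transfiniteCompositions, h⟩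
  · rintro ⟨S, g, hg, rfl⟩
    rw [relativeCellComplexes_iff_hasTower] at hg
    have hinl := hasTower_coprod_inl (K := tildeI I) X (𝟙_ C) (Or.inr rfl) S
    exact (HasTower.transfiniteCompositions_comp hinl.transfiniteCompositions
      (hg.mono (pushoutsOf_mono fun _ _ _ => Or.inl))).of_sup_isomorphisms

end Muro
end

section
/- Under the Setup, an object of M is cofibrant mod 𝟙 in M if and only if it is cofibrant in the model structure M̃. -/
open CategoryTheory CategoryTheory.Limits MonoidalCategory

universe v u v' u'

namespace Muro

variable {C : Type u} [Category.{v} C]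

/-- Maps out of an object `A` lift through `p` as soon as `∅ ⟶ A` has the left
lifting property with respect to `p`. -/
lemma exists_lift_of_initial [HasInitial C] {A X Y : C} (p : X ⟶ Y)
    [HasLiftingProperty (initial.to A) p] (f : A ⟶ Y) : ∃ g : A ⟶ X, g ≫ p = f := by
  have sq : CommSq (initial.to X) (initial.to A) p f := ⟨initial.hom_ext _ _⟩
  exact ⟨sq.lift, sq.fac_right⟩

/-- Right lifting against `Ĩ` amounts to right lifting against `I` together with
surjectivity on maps out of the tensor unit. -/
lemma rlp_tildeI_iff [MonoidalCategory C] [HasInitial C] (I : MorphismProperty C)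
    {X Y : C} (p : X ⟶ Y) :
    rlp (tildeI I) p ↔ rlp I p ∧ SurjectiveOnUnit p := by
  refine ⟨fun h => ⟨fun _ _ i hi => h i (Or.inl hi), fun y => ?_⟩, fun ⟨hI, hs⟩ => ?_⟩
  · have := h (initial.to (𝟙_ C)) (Or.inr rfl)
    exact exists_lift_of_initial p y
  · rintro A B i (hi | hi)
    · exact hI i hi
    · have : HasLiftingProperty (initial.to (𝟙_ C)) p := ⟨fun {_ y} _ => by
        obtain ⟨x, hx⟩ := hs y
        exact ⟨⟨⟨x, initial.hom_ext _ _, hx⟩⟩⟩⟩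
      exact HasLiftingProperty.of_arrow_iso_left (eqToIso hi.symm) p

/-- Under the Setup, an object of `M` is cofibrant mod `𝟙`
in `M` if and only if it is cofibrant in the model structure `M̃`. -/
theorem cofibrantModOne_iff_tilde_cofibrant {C : Type u} [Category.{v} C]
    [MonoidalCategory C] [HasInitial C] [HasPushouts C]
    [HasBinaryCoproducts C] [HasCoproducts.{v} C] (S : Setup C)
    (Mt : ModelStructure C) (hMt : S.IsTildeModel Mt) (A : C) :
    CofibrantModOne S.M A ↔ Mt.Cofibrant A := by
  have trivFib_iff {X Y : C} (p : X ⟶ Y) :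
      rlp S.tI p ↔ S.M.TrivFib p ∧ SurjectiveOnUnit p := by
    rw [S.cofGen.trivFib_eq]
    exact rlp_tildeI_iff S.I p
  unfold ModelStructure.Cofibrant
  rw [hMt.cof_eq]
  constructor
  · rintro ⟨X, i, r, hir, s, c, hc⟩ E B p hp
    obtain ⟨⟨hfib, hw⟩, hs⟩ := (trivFib_iff p).1 hp
    have := S.M.lift_cof_trivFib c p hc hfib hw
    refine ⟨fun {_ y} _ => ?_⟩
    choose x hx using fun k => hs (Sigma.ι (fun _ : s => 𝟙_ C) k ≫ c ≫ r ≫ y)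
    have sq : CommSq (Sigma.desc x) c p (r ≫ y) :=
      ⟨Sigma.hom_ext _ _ fun k => by simpa using hx k⟩
    refine ⟨⟨⟨i ≫ sq.lift, initial.hom_ext _ _, ?_⟩⟩⟩
    rw [Category.assoc, sq.fac_right, reassoc_of% hir]
  · intro hA
    obtain ⟨X, c, p, hc, hfib, hw, hcp⟩ :=
      S.M.factor_cof_trivFib (Sigma.desc fun a : 𝟙_ C ⟶ A => a)
    have hs : SurjectiveOnUnit p := fun a =>
      ⟨Sigma.ι (fun _ : 𝟙_ C ⟶ A => 𝟙_ C) a ≫ c, by simp [hcp]⟩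
    have := hA p ((trivFib_iff p).2 ⟨⟨hfib, hw⟩, hs⟩)
    obtain ⟨i, hi⟩ := exists_lift_of_initial p (𝟙 A)
    exact ⟨X, i, p, hi, _, c, hc⟩

end Muro
end

section
/- Under the Setup, the adjunction given by the identity functors id: M ⇄ M̃: id is a monoidal Quillen equivalence: the identity functor M → M̃ is a strong monoidal left Quillen functor (it preserves cofibrations and trivial cofibrations) and the adjoint pair is a Quillen equivalence. -/
open CategoryTheory CategoryTheory.Limits MonoidalCategory

universe v u v' u'

namespace Muro

/-- The cofibrations of `M` are cofibrations of `M̃`: an `Ĩ`-injective map is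
`I`-injective, hence a trivial fibration of `M`. -/
lemma Setup.IsTildeModel.cof_of_cof {C : Type u} [Category.{v} C]
    [MonoidalCategory C] [HasInitial C] [HasPushouts C] [HasBinaryCoproducts C]
    {S : Setup C} {Mt : ModelStructure C} (hMt : S.IsTildeModel Mt)
    ⦃X Y : C⦄ (f : X ⟶ Y) (hf : S.M.Cof f) : Mt.Cof f := by
  rw [hMt.cof_eq]
  intro A B p hp
  have hp' : S.M.TrivFib p := by
    rw [S.cofGen.trivFib_eq]
    exact fun _ _ i hi => hp i (Or.inl hi)
  exact S.M.lift_cof_trivFib f p hf hp'.1 hp'.2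

/-- Under the Setup, the identity adjunction `M ⇄ M̃` is a
monoidal Quillen equivalence: the identity functor `M → M̃` (which is strictly,
hence strongly, monoidal) preserves cofibrations and trivial cofibrations, the
adjoint pair is a Quillen equivalence (a map `f : X ⟶ Y` with `X` cofibrant in
`M` and `Y` fibrant in `M̃` is a weak equivalence in `M̃` if and only if its
adjoint, which is `f` itself, is one in `M`), and the image of any cofibrant
resolution of the tensor unit of `M` is a weak equivalence in `M̃`. -/
theorem identity_monoidal_quillen_equivalence {C : Type u} [Category.{v} C]
    [MonoidalCategory C] [HasInitial C] [HasTerminal C] [HasPushouts C]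
    [HasBinaryCoproducts C] (S : Setup C)
    (Mt : ModelStructure C) (hMt : S.IsTildeModel Mt) :
    (∀ ⦃X Y : C⦄ (f : X ⟶ Y), S.M.Cof f → Mt.Cof f) ∧
    (∀ ⦃X Y : C⦄ (f : X ⟶ Y), S.M.Cof f → S.M.W f → Mt.Cof f ∧ Mt.W f) ∧
    (∀ ⦃X Y : C⦄ (f : X ⟶ Y), S.M.Cofibrant X → Mt.Fibrant Y →
      (Mt.W f ↔ S.M.W f)) ∧
    (∀ (T' : C) (q' : T' ⟶ 𝟙_ C),
      IsCofibrantResolutionOfUnit S.M q' → Mt.W q') := by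
  rw [hMt.weq_eq]
  exact ⟨hMt.cof_of_cof, fun _ _ f hf hw => ⟨hMt.cof_of_cof f hf, hw⟩,
    fun _ _ _ _ _ => Iff.rfl, fun _ _ hq' => hq'.2⟩

end Muro
end

section
/- Under the Setup, every map in M with the right lifting property with respect to Ĩ is a weak equivalence and has the right lifting property with respect to J̃. In particular, every Ĩ-injective map f: X → Y has the right lifting property with respect to the single map j∘i₁: 𝟙̃ → C. -/
open CategoryTheory CategoryTheory.Limits MonoidalCategory

universe v u v' u'

namespace Muro

/-- A trivial fibration which is surjective on maps out of the tensor unit has the right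
lifting property with respect to `j ∘ i₁`. -/
theorem Setup.hasLiftingProperty_ji₁ {C : Type u} [Category.{v} C] [MonoidalCategory C]
    [HasInitial C] [HasPushouts C] [HasBinaryCoproducts C] (S : Setup C) {X Y : C} {f : X ⟶ Y}
    (hf : S.M.TrivFib f) (hs : SurjectiveOnUnit f) : HasLiftingProperty S.ji₁ f where
  sq_hasLift {u w} sq := by
    obtain ⟨g, hg⟩ := hs ((coprod.inr : 𝟙_ C ⟶ S.T ⨿ 𝟙_ C) ≫ S.j ≫ w)
    have := S.M.lift_cof_trivFib S.j f S.cof_j hf.1 hf.2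
    have sq' : CommSq (coprod.desc u g) S.j f w := ⟨by
      ext
      · simpa [Setup.ji₁, coprod.inl_desc] using sq.w
      · simpa [coprod.inr_desc] using hg⟩
    exact ⟨⟨⟨sq'.lift, by simp [Setup.ji₁, coprod.inl_desc], sq'.fac_right⟩⟩⟩

/-- A map with the right lifting property with respect to `∅ ⟶ 𝟙` is surjective on maps out of
the tensor unit. -/
theorem surjectiveOnUnit_of_hasLiftingProperty {C : Type u} [Category.{v} C]
    [MonoidalCategory C] [HasInitial C] {X Y : C} (f : X ⟶ Y)
    [HasLiftingProperty (initial.to (𝟙_ C)) f] : SurjectiveOnUnit f := fun y =>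
  have sq : CommSq (initial.to X) (initial.to (𝟙_ C)) f y := ⟨Subsingleton.elim _ _⟩
  ⟨sq.lift, sq.fac_right⟩

/-- Under the Setup, every `Ĩ`-injective map is a weak
equivalence and is `J̃`-injective; in particular, every `Ĩ`-injective map has
the right lifting property with respect to the single map `j ∘ i₁ : 𝟙̃ ⟶ C`. -/
theorem tildeI_injective_weq_and_tildeJ_injective {C : Type u}
    [Category.{v} C] [MonoidalCategory C] [HasInitial C] [HasPushouts C]
    [HasBinaryCoproducts C] (S : Setup C) :
    ∀ ⦃X Y : C⦄ (f : X ⟶ Y), rlp S.tI f →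
      (S.M.W f ∧ rlp S.tJ f) ∧ HasLiftingProperty S.ji₁ f := by
  intro X Y f hf
  have hTF : S.M.TrivFib f := by
    rw [S.cofGen.trivFib_eq]
    exact fun _ _ i hi => hf i (Or.inl hi)
  have := hf (initial.to (𝟙_ C)) (Or.inr rfl)
  have hl := S.hasLiftingProperty_ji₁ hTF (surjectiveOnUnit_of_hasLiftingProperty f)
  refine ⟨⟨hTF.2, ?_⟩, hl⟩
  rintro A B i (hi | hi)
  · have hFib := hTF.1
    rw [S.cofGen.fib_eq] at hFib
    exact hFib i hi
  · cases hi
    exact hl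

end Muro
end
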